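/- arXiv:1903.03840 — 8 statements merged into one kernel-verified Lean document; each statement's English description precedes it below -/
import Mathlib

section
/- Let T > 0 and let ξ : ℝ → ℝ³ be measurable, T-periodic, square-integrable on [0,T], with ∫₀ᵀ ξ(t) dt = 0. Then for every t ∈ ℝ one has ‖∫₀ᵗ ξ(s) ds‖ ≤ √(T/3) · (∫₀ᵀ ‖ξ(s)‖² ds)^{1/2}. In particular the antiderivative x₀(t) := ∫₀ᵗ ξ(s) ds is uniformly bounded on ℝ. -/
open MeasureTheory

/-- Cauchy–Schwarz against the constant function `1` on `[a, b]`. -/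
lemma sq_intervalIntegral_le {a b : ℝ} (hab : a < b) {f : ℝ → ℝ}
    (hf : IntervalIntegrable f volume a b)
    (hf2 : IntervalIntegrable (fun t => f t ^ 2) volume a b) :
    (∫ t in a..b, f t) ^ 2 ≤ (b - a) * ∫ t in a..b, f t ^ 2 := by
  have hba : 0 < b - a := sub_pos.2 hab
  set J := ∫ t in a..b, f t with hJ
  set c := J / (b - a) with hc
  have hcJ : c * (b - a) = J := div_mul_cancel₀ _ hba.ne'
  have hnonneg : 0 ≤ ∫ t in a..b, (f t ^ 2 - 2 * c * f t + c ^ 2) :=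
    intervalIntegral.integral_nonneg hab.le fun t _ => by nlinarith [sq_nonneg (f t - c)]
  rw [intervalIntegral.integral_add (hf2.sub (hf.const_mul _)) intervalIntegrable_const,
    intervalIntegral.integral_sub hf2 (hf.const_mul _), intervalIntegral.integral_const_mul,
    intervalIntegral.integral_const, smul_eq_mul, ← hJ] at hnonneg
  have hmul := mul_nonneg hba.le hnonneg
  have hexpand : (b - a) * ((∫ t in a..b, f t ^ 2) - 2 * c * J + (b - a) * c ^ 2) =
      (b - a) * (∫ t in a..b, f t ^ 2) - 2 * (c * (b - a)) * J + (c * (b - a)) ^ 2 := by ring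
  rw [hexpand, hcJ] at hmul
  linarith

/-- If the integral over `[a, b]` vanishes, then the antiderivative starting at `a` is bounded on
`[a, b]` by half of the `L¹` norm. -/
lemma two_mul_norm_intervalIntegral_le_of_integral_eq_zero {E : Type*} [NormedAddCommGroup E]
    [NormedSpace ℝ E] {f : ℝ → E} {a b t : ℝ} (hf : IntervalIntegrable f volume a b)
    (hzero : (∫ s in a..b, f s) = 0) (hat : a ≤ t) (htb : t ≤ b) :
    2 * ‖∫ s in a..t, f s‖ ≤ ∫ s in a..b, ‖f s‖ := by
  have ht : t ∈ Set.uIcc a b := Set.mem_uIcc_of_le hat htb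
  have hleft : IntervalIntegrable f volume a t :=
    hf.mono_set (Set.uIcc_subset_uIcc_left ht)
  have hright : IntervalIntegrable f volume t b :=
    hf.mono_set (Set.uIcc_subset_uIcc_right ht)
  have hsum := intervalIntegral.integral_add_adjacent_intervals hleft hright
  rw [hzero] at hsum
  have hnorm : ‖∫ s in a..t, f s‖ = ‖∫ s in t..b, f s‖ := by
    rw [eq_neg_of_add_eq_zero_left hsum, norm_neg]
  have hsplit := intervalIntegral.integral_add_adjacent_intervals hleft.norm hright.norm
  have h₁ := intervalIntegral.norm_integral_le_integral_norm (f := f) (μ := volume) hat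
  have h₂ := intervalIntegral.norm_integral_le_integral_norm (f := f) (μ := volume) htb
  linarith

/-- Uniform bound on the antiderivative of a measurable, `T`-periodic, square-integrable
function `ξ : ℝ → ℝ³` with zero average over a period:
`‖∫₀ᵗ ξ‖ ≤ √(T/3) · (∫₀ᵀ ‖ξ‖²)^{1/2}` for every `t`. -/
theorem antiderivative_bound_of_zero_average
    (T : ℝ) (hT : 0 < T) (ξ : ℝ → EuclideanSpace ℝ (Fin 3))
    (hmeas : Measurable ξ)
    (hper : ∀ t : ℝ, ξ (t + T) = ξ t)
    (hL2 : IntegrableOn (fun t => ‖ξ t‖ ^ 2) (Set.Icc 0 T))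
    (hzero : (∫ t in (0:ℝ)..T, ξ t) = 0) :
    ∀ t : ℝ, ‖∫ s in (0:ℝ)..t, ξ s‖ ≤
      Real.sqrt (T / 3) * (∫ s in (0:ℝ)..T, ‖ξ s‖ ^ 2) ^ ((1:ℝ)/2) := by
  have hξper : Function.Periodic ξ T := hper
  have hsq : IntervalIntegrable (fun t => ‖ξ t‖ ^ 2) volume 0 T :=
    (intervalIntegrable_iff_integrableOn_Icc_of_le hT.le).2 hL2
  have hint : IntervalIntegrable ξ volume 0 T := by
    refine (hsq.add (intervalIntegrable_const (c := (1 : ℝ)))).mono_fun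
      hmeas.aestronglyMeasurable (Filter.Eventually.of_forall fun t => ?_)
    refine le_trans ?_ (le_abs_self _)
    change ‖ξ t‖ ≤ ‖ξ t‖ ^ 2 + 1
    nlinarith [sq_nonneg (‖ξ t‖ - 1), sq_nonneg ‖ξ t‖]
  have hintall : ∀ a b : ℝ, IntervalIntegrable ξ volume a b :=
    fun a b => hξper.intervalIntegrable₀ hT.ne' hint a b
  have hprim : Function.Periodic (fun t => ∫ s in (0:ℝ)..t, ξ s) T := fun t => by
    have hperiod := hξper.intervalIntegral_add_eq t 0
    rw [zero_add, hzero] at hperiod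
    change (∫ s in (0:ℝ)..(t + T), ξ s) = ∫ s in (0:ℝ)..t, ξ s
    rw [← intervalIntegral.integral_add_adjacent_intervals (hintall 0 t) (hintall t (t + T)),
      hperiod, add_zero]
  intro t
  obtain ⟨r, hr, hrt⟩ := hprim.exists_mem_Ico₀ hT t
  rw [hrt, ← Real.sqrt_eq_rpow, ← Real.sqrt_mul (by positivity)]
  apply Real.le_sqrt_of_sq_le
  have hL1 := two_mul_norm_intervalIntegral_le_of_integral_eq_zero hint hzero hr.1 hr.2.le
  have hCS := sq_intervalIntegral_le hT hint.norm hsq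
  have hpow := pow_le_pow_left₀ (by positivity) hL1 2
  have hnonneg : 0 ≤ ∫ s in (0:ℝ)..T, ‖ξ s‖ ^ 2 :=
    intervalIntegral.integral_nonneg hT.le fun s _ => by positivity
  have hprod := mul_nonneg hT.le hnonneg
  rw [sub_zero] at hCS
  linarith
end

section
/- Let α ∈ [0,1). There exists a constant C = C(α) > 0 such that for every x ∈ ℝ³, ∫_{ℝ³} ‖x−y‖⁻² (1+‖y‖)^{-(2+α)} dy ≤ C (1+‖x‖)^{-(1+α)}. -/
open MeasureTheory

lemma norm_rpow_mul_add_norm_rpow_eq_comp_smul {E : Type*} [NormedAddCommGroup E]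
    [NormedSpace ℝ E] {R : ℝ} (hR : 0 < R) (a b : ℝ) (z : E) :
    ‖z‖ ^ (-a) * (R + ‖z‖) ^ (-b) =
      R ^ (-(a + b)) * (‖R⁻¹ • z‖ ^ (-a) * (1 + ‖R⁻¹ • z‖) ^ (-b)) := by
  have h1 : ‖z‖ = R * ‖R⁻¹ • z‖ := by
    rw [norm_smul, Real.norm_of_nonneg (by positivity), mul_inv_cancel_left₀ hR.ne']
  have h2 : R + ‖z‖ = R * (1 + ‖R⁻¹ • z‖) := by rw [h1]; ring
  rw [h2, h1, Real.mul_rpow hR.le (norm_nonneg _), Real.mul_rpow hR.le (by positivity),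
    neg_add, Real.rpow_add hR]
  ring

section RadialProfile

variable {E : Type*} [NormedAddCommGroup E] [NormedSpace ℝ E] [FiniteDimensional ℝ E]
  [MeasurableSpace E] [BorelSpace E] (μ : Measure E) [μ.IsAddHaarMeasure]

/-- `‖z‖ ^ (-a) * (1 + ‖z‖) ^ (-b)` is integrable when `a < dim E < a + b`. -/
lemma integrable_norm_rpow_mul_one_add_norm_rpow (hd : 1 ≤ Module.finrank ℝ E) {a b : ℝ}
    (ha : 0 ≤ a) (hb : 0 ≤ b) (had : a < Module.finrank ℝ E) (hab : Module.finrank ℝ E < a + b) :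
    Integrable (fun z : E ↦ ‖z‖ ^ (-a) * (1 + ‖z‖) ^ (-b)) μ := by
  have hmeas : AEStronglyMeasurable (fun z : E ↦ ‖z‖ ^ (-a) * (1 + ‖z‖) ^ (-b)) μ :=
    Measurable.aestronglyMeasurable (by fun_prop)
  rw [← integrableOn_univ, ← Set.union_compl_self (Metric.ball (0 : E) 1), integrableOn_union]
  constructor
  · refine integrableOn_ball_of_norm_le_rpow hd (C := 1) had (.of_forall fun z ↦ ?_) hmeas
    rw [Real.norm_of_nonneg (by positivity), one_mul]
    refine mul_le_of_le_one_right (by positivity) ?_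
    exact Real.rpow_le_one_of_one_le_of_nonpos (by linarith [norm_nonneg z])
      (neg_nonpos.2 hb)
  · refine Integrable.mono' (((integrable_one_add_norm (μ := μ) hab).const_mul (2 ^ a)).restrict)
      hmeas.restrict ?_
    refine (ae_restrict_iff' Metric.isOpen_ball.measurableSet.compl).2 (.of_forall fun z hz ↦ ?_)
    have hz1 : 1 ≤ ‖z‖ := by simpa using hz
    have hpos : 0 < 1 + ‖z‖ := by linarith
    rw [Real.norm_of_nonneg (by positivity), neg_add, Real.rpow_add hpos, ← mul_assoc]
    gcongr
    calc ‖z‖ ^ (-a) ≤ ((1 + ‖z‖) / 2) ^ (-a) :=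
          Real.rpow_le_rpow_of_nonpos (by positivity) (by linarith) (by linarith)
      _ = 2 ^ a * (1 + ‖z‖) ^ (-a) := by
          rw [Real.div_rpow hpos.le (by norm_num), Real.rpow_neg (by norm_num : (0 : ℝ) ≤ 2),
            div_inv_eq_mul, mul_comm]

lemma integrable_norm_rpow_mul_add_norm_rpow (hd : 1 ≤ Module.finrank ℝ E) {a b R : ℝ}
    (ha : 0 ≤ a) (hb : 0 ≤ b) (had : a < Module.finrank ℝ E) (hab : Module.finrank ℝ E < a + b)
    (hR : 0 < R) :
    Integrable (fun z : E ↦ ‖z‖ ^ (-a) * (R + ‖z‖) ^ (-b)) μ := by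
  simp_rw [norm_rpow_mul_add_norm_rpow_eq_comp_smul hR]
  exact ((integrable_norm_rpow_mul_one_add_norm_rpow μ hd ha hb had hab).comp_smul
    (inv_ne_zero hR.ne')).const_mul _

lemma integral_norm_rpow_mul_add_norm_rpow {R : ℝ} (hR : 0 < R) (a b : ℝ) :
    ∫ z : E, ‖z‖ ^ (-a) * (R + ‖z‖) ^ (-b) ∂μ =
      R ^ (Module.finrank ℝ E - (a + b)) * ∫ z : E, ‖z‖ ^ (-a) * (1 + ‖z‖) ^ (-b) ∂μ := by
  simp_rw [norm_rpow_mul_add_norm_rpow_eq_comp_smul hR]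
  rw [integral_const_mul,
    Measure.integral_comp_inv_smul μ (fun z : E ↦ ‖z‖ ^ (-a) * (1 + ‖z‖) ^ (-b)),
    abs_of_pos (by positivity), smul_eq_mul, ← mul_assoc, sub_eq_neg_add, Real.rpow_add hR,
    Real.rpow_natCast]

end RadialProfile

lemma rpow_neg_le_of_le_mul {c s t p : ℝ} (hc : 0 < c) (hs : 0 < s) (h : s ≤ c * t)
    (hp : 0 ≤ p) : t ^ (-p) ≤ c ^ p * s ^ (-p) := by
  calc t ^ (-p) ≤ (s / c) ^ (-p) :=
        Real.rpow_le_rpow_of_nonpos (by positivity) (by rw [div_le_iff₀ hc]; linarith) (by linarith)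
    _ = c ^ p * s ^ (-p) := by
        rw [Real.div_rpow hs.le hc.le, Real.rpow_neg hc.le, div_inv_eq_mul, mul_comm]

/-- Away from `x` the kernel is comparable to `(1 + ‖x‖ + ‖y‖) ^ (-p)`, and near `x` the weight is
comparable to `(1 + ‖x‖ + ‖x - y‖) ^ (-q)`. -/
lemma norm_sub_rpow_mul_one_add_norm_rpow_le {E : Type*} [NormedAddCommGroup E] {p q : ℝ}
    (hp : 0 ≤ p) (hq : 0 ≤ q) (x : E) {y : E} (hy : y ≠ 0) :
    ‖x - y‖ ^ (-p) * (1 + ‖y‖) ^ (-q) ≤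
      9 ^ p * (‖y‖ ^ (-q) * (1 + ‖x‖ + ‖y‖) ^ (-p)) +
        9 ^ q * (‖x - y‖ ^ (-p) * (1 + ‖x‖ + ‖x - y‖) ^ (-q)) := by
  have hy' : 0 < ‖y‖ := norm_pos_iff.2 hy
  have hx := norm_nonneg x
  have hxy := norm_nonneg (x - y)
  have h1 : ‖y‖ ≤ ‖x‖ + ‖x - y‖ := norm_le_norm_add_norm_sub x y
  have h2 : ‖x‖ ≤ ‖y‖ + ‖x - y‖ := by
    rw [norm_sub_rev]; exact norm_le_norm_add_norm_sub y x
  rcases le_total (1 + ‖x‖) (4 * ‖x - y‖) with h | h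
  · refine le_add_of_le_of_nonneg ?_ (by positivity)
    calc ‖x - y‖ ^ (-p) * (1 + ‖y‖) ^ (-q)
        ≤ (9 ^ p * (1 + ‖x‖ + ‖y‖) ^ (-p)) * ‖y‖ ^ (-q) := by
          refine mul_le_mul ?_ ?_ (by positivity) (by positivity)
          · exact rpow_neg_le_of_le_mul (by norm_num) (by positivity) (by linarith) hp
          · exact Real.rpow_le_rpow_of_nonpos hy' (by linarith) (by linarith)
      _ = _ := by ring
  · refine le_add_of_nonneg_of_le (by positivity) ?_
    calc ‖x - y‖ ^ (-p) * (1 + ‖y‖) ^ (-q)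
        ≤ ‖x - y‖ ^ (-p) * (9 ^ q * (1 + ‖x‖ + ‖x - y‖) ^ (-q)) := by
          gcongr
          exact rpow_neg_le_of_le_mul (by norm_num) (by positivity) (by linarith) hq
      _ = _ := by ring

/-- Weighted convolution estimate: for `α ∈ [0,1)` there is `C = C(α) > 0` such that
`∫_{ℝ³} ‖x−y‖⁻² (1+‖y‖)^{-(2+α)} dy ≤ C (1+‖x‖)^{-(1+α)}` for all `x ∈ ℝ³`. -/
theorem weighted_convolution_estimate
    (α : ℝ) (hα : α ∈ Set.Ico (0:ℝ) 1) :
    ∃ C > 0, ∀ x : EuclideanSpace ℝ (Fin 3),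
      (∫ y : EuclideanSpace ℝ (Fin 3),
        ‖x - y‖ ^ (-2 : ℝ) * (1 + ‖y‖) ^ (-(2 + α)))
        ≤ C * (1 + ‖x‖) ^ (-(1 + α)) := by
  obtain ⟨hα0, hα1⟩ := hα
  set I := ∫ z : EuclideanSpace ℝ (Fin 3), ‖z‖ ^ (-(2 + α)) * (1 + ‖z‖) ^ (-2 : ℝ) with hI
  set J := ∫ z : EuclideanSpace ℝ (Fin 3), ‖z‖ ^ (-2 : ℝ) * (1 + ‖z‖) ^ (-(2 + α)) with hJ
  have hI0 : 0 ≤ I := integral_nonneg fun z ↦ by positivity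
  have hJ0 : 0 ≤ J := integral_nonneg fun z ↦ by positivity
  refine ⟨9 ^ (2 : ℝ) * I + 9 ^ (2 + α) * J + 1, by positivity, fun x ↦ ?_⟩
  have hd : Module.finrank ℝ (EuclideanSpace ℝ (Fin 3)) = 3 := by simp
  have hR : 0 < 1 + ‖x‖ := by positivity
  have hint₁ := integrable_norm_rpow_mul_add_norm_rpow
    (volume : Measure (EuclideanSpace ℝ (Fin 3))) (a := 2 + α) (b := 2) (by simp)
    (by linarith) (by norm_num) (by rw [hd]; push_cast; linarith)
    (by rw [hd]; push_cast; linarith) hR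
  have hint₂ := integrable_norm_rpow_mul_add_norm_rpow
    (volume : Measure (EuclideanSpace ℝ (Fin 3))) (a := 2) (b := 2 + α) (by simp)
    (by norm_num) (by linarith) (by rw [hd]; norm_num) (by rw [hd]; push_cast; linarith) hR
  have hint₂' := hint₂.comp_sub_left x
  calc ∫ y, ‖x - y‖ ^ (-2 : ℝ) * (1 + ‖y‖) ^ (-(2 + α))
      ≤ ∫ y, (9 ^ (2 : ℝ) * (‖y‖ ^ (-(2 + α)) * (1 + ‖x‖ + ‖y‖) ^ (-2 : ℝ)) +
        9 ^ (2 + α) * (‖x - y‖ ^ (-2 : ℝ) * (1 + ‖x‖ + ‖x - y‖) ^ (-(2 + α)))) := by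
        refine integral_mono_of_nonneg (.of_forall fun y ↦ by positivity)
          ((hint₁.const_mul _).add (hint₂'.const_mul _)) ?_
        filter_upwards [Measure.ae_ne volume (0 : EuclideanSpace ℝ (Fin 3))] with y hy
        exact norm_sub_rpow_mul_one_add_norm_rpow_le (by norm_num) (by linarith) x hy
    _ = (9 ^ (2 : ℝ) * I + 9 ^ (2 + α) * J) * (1 + ‖x‖) ^ (-(1 + α)) := by
        rw [integral_add (hint₁.const_mul _) (hint₂'.const_mul _), integral_const_mul,
          integral_const_mul, integral_sub_left_eq_self
            (fun z ↦ ‖z‖ ^ (-2 : ℝ) * (1 + ‖x‖ + ‖z‖) ^ (-(2 + α))) volume x,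
          integral_norm_rpow_mul_add_norm_rpow volume hR,
          integral_norm_rpow_mul_add_norm_rpow volume hR, hd, ← hI, ← hJ,
          show ((3 : ℕ) : ℝ) - (2 + α + 2) = -(1 + α) by push_cast; ring,
          show ((3 : ℕ) : ℝ) - (2 + (2 + α)) = -(1 + α) by push_cast; ring]
        ring
    _ ≤ _ := by
        exact mul_le_mul_of_nonneg_right (le_add_of_nonneg_right zero_le_one) (by positivity)
end

section
/- There exists a constant C > 0 such that for every x ∈ ℝ³ with ‖x‖ ≥ 2, ∫_{‖y‖ ≥ ‖x‖/2} ‖x−y‖⁻² (1+‖y‖)⁻⁴ dy ≤ C ‖x‖⁻³. -/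
open MeasureTheory

lemma integrable_inv_norm_sq_mul_inv_one_add_norm_pow_four :
    Integrable fun u : EuclideanSpace ℝ (Fin 3) ↦ (‖u‖ ^ 2)⁻¹ * ((1 + ‖u‖) ^ 4)⁻¹ := by
  refine (integrable_fun_norm_addHaar volume
    (f := fun t : ℝ ↦ (t ^ 2)⁻¹ * ((1 + t) ^ 4)⁻¹)).2 ?_
  have h : Integrable fun t : ℝ ↦ (1 + ‖t‖) ^ (-4 : ℝ) :=
    integrable_one_add_norm (by norm_num)
  refine h.integrableOn.congr_fun (fun t (ht : 0 < t) ↦ ?_) measurableSet_Ioi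
  have h1 : (1 + t) ^ (-4 : ℝ) = ((1 + t) ^ 4)⁻¹ := by
    rw [Real.rpow_neg (by positivity)]
    norm_cast
  simp only [Real.norm_of_nonneg ht.le, h1, finrank_euclideanSpace_fin, smul_eq_mul]
  field_simp

lemma inv_norm_sub_sq_mul_inv_one_add_norm_pow_four_le {E : Type*} [NormedAddCommGroup E]
    [NormedSpace ℝ E] {x y : E} (hx : x ≠ 0) (hy : ‖x‖ / 2 ≤ ‖y‖) :
    (‖x - y‖ ^ 2)⁻¹ * ((1 + ‖y‖) ^ 4)⁻¹ ≤ 625 * (‖x‖ ^ 6)⁻¹ *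
      ((‖‖x‖⁻¹ • (x - y)‖ ^ 2)⁻¹ * ((1 + ‖‖x‖⁻¹ • (x - y)‖) ^ 4)⁻¹) := by
  have hr : 0 < ‖x‖ := norm_pos_iff.2 hx
  have key : (‖x‖ + ‖x - y‖) / 5 ≤ 1 + ‖y‖ := by linarith [norm_sub_le x y]
  calc (‖x - y‖ ^ 2)⁻¹ * ((1 + ‖y‖) ^ 4)⁻¹
      ≤ (‖x - y‖ ^ 2)⁻¹ * (((‖x‖ + ‖x - y‖) / 5) ^ 4)⁻¹ := by gcongr
    _ = _ := by
      rw [norm_smul, norm_inv, norm_norm,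
        show 1 + ‖x‖⁻¹ * ‖x - y‖ = ‖x‖⁻¹ * (‖x‖ + ‖x - y‖) by field_simp]
      simp only [mul_pow, div_pow, mul_inv, inv_pow, inv_inv, inv_div]
      field_simp
      norm_num

/-- Far-field estimate (2.61): there is `C > 0` such that for every `x ∈ ℝ³` with `‖x‖ ≥ 2`,
`∫_{‖y‖ ≥ ‖x‖/2} ‖x−y‖⁻² (1+‖y‖)⁻⁴ dy ≤ C ‖x‖⁻³`. -/
theorem far_field_decay4_estimate :
    ∃ C > 0, ∀ x : EuclideanSpace ℝ (Fin 3), 2 ≤ ‖x‖ →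
      (∫ y in {y : EuclideanSpace ℝ (Fin 3) | ‖x‖ / 2 ≤ ‖y‖},
        (‖x - y‖ ^ 2)⁻¹ * ((1 + ‖y‖) ^ 4)⁻¹)
        ≤ C * (‖x‖ ^ 3)⁻¹ := by
  set g : EuclideanSpace ℝ (Fin 3) → ℝ := fun u ↦ (‖u‖ ^ 2)⁻¹ * ((1 + ‖u‖) ^ 4)⁻¹
  have hgi : Integrable g := integrable_inv_norm_sq_mul_inv_one_add_norm_pow_four
  have hg0 : 0 ≤ ∫ u, g u := integral_nonneg fun u ↦ by positivity
  refine ⟨625 * (∫ u, g u) + 1, by positivity, fun x hx ↦ ?_⟩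
  have hr : 0 < ‖x‖ := by linarith
  have hs : MeasurableSet {y : EuclideanSpace ℝ (Fin 3) | ‖x‖ / 2 ≤ ‖y‖} :=
    measurableSet_le measurable_const measurable_norm
  have hint : Integrable fun y ↦ 625 * (‖x‖ ^ 6)⁻¹ * g (‖x‖⁻¹ • (x - y)) :=
    (((integrable_comp_smul_iff volume g (inv_ne_zero hr.ne')).2 hgi).comp_sub_left x).const_mul _
  calc _ ≤ ∫ y in {y : EuclideanSpace ℝ (Fin 3) | ‖x‖ / 2 ≤ ‖y‖},
        625 * (‖x‖ ^ 6)⁻¹ * g (‖x‖⁻¹ • (x - y)) := by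
        refine integral_mono_of_nonneg (ae_of_all _ fun y ↦ by positivity) hint.integrableOn ?_
        exact (ae_restrict_iff' hs).2 (ae_of_all _ fun y hy ↦
          inv_norm_sub_sq_mul_inv_one_add_norm_pow_four_le (norm_pos_iff.1 hr) hy)
    _ ≤ ∫ y, 625 * (‖x‖ ^ 6)⁻¹ * g (‖x‖⁻¹ • (x - y)) :=
        setIntegral_le_integral hint (ae_of_all _ fun y ↦ by positivity)
    _ = 625 * (∫ u, g u) * (‖x‖ ^ 3)⁻¹ := by
        rw [integral_const_mul, integral_sub_left_eq_self (fun y ↦ g (‖x‖⁻¹ • y)) volume x,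
          Measure.integral_comp_inv_smul_of_nonneg volume g hr.le, finrank_euclideanSpace_fin,
          smul_eq_mul]
        field_simp
    _ ≤ (625 * (∫ u, g u) + 1) * (‖x‖ ^ 3)⁻¹ := by
        gcongr
        linarith
end

section
/- Let ρ > 0 and let f : ℝ³ → ℝ be Lebesgue integrable with support contained in the closed ball B(0,2ρ). Define E(z) := 1/(4π‖z‖) for z ≠ 0. Then there exists a constant C = C(ρ) > 0 such that for every x ∈ ℝ³ with ‖x‖ ≥ 4ρ, |∫_{ℝ³} (E(x−y) − E(x)) f(y) dy| ≤ C ‖x‖⁻² ∫_{ℝ³} |f(y)| dy. -/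
open MeasureTheory

/-- Increments of `z ↦ ‖z‖⁻¹` by a vector `y` of length at most `‖x‖ / 2`. -/
theorem abs_inv_norm_sub_sub_inv_norm_le {V : Type*} [SeminormedAddCommGroup V] {x y : V}
    (hx : 0 < ‖x‖) (hy : 2 * ‖y‖ ≤ ‖x‖) :
    |‖x - y‖⁻¹ - ‖x‖⁻¹| ≤ 2 * ‖y‖ * (‖x‖ ^ 2)⁻¹ := by
  have hxy : ‖x‖ / 2 ≤ ‖x - y‖ := by linarith [norm_sub_norm_le x y]
  have hpos : 0 < ‖x - y‖ := by linarith
  have hdiff : |‖x‖ - ‖x - y‖| ≤ ‖y‖ := by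
    simpa using abs_norm_sub_norm_le x (x - y)
  rw [inv_sub_inv hpos.ne' hx.ne', abs_div, abs_of_pos (mul_pos hpos hx)]
  calc |‖x‖ - ‖x - y‖| / (‖x - y‖ * ‖x‖) ≤ ‖y‖ / (‖x‖ / 2 * ‖x‖) := by gcongr
    _ = 2 * ‖y‖ * (‖x‖ ^ 2)⁻¹ := by field_simp

/-- Mean-value-theorem estimate (2.93)–(2.94) for the Newtonian potential: for `ρ > 0`
there is `C = C(ρ) > 0` such that for every integrable `f` supported in `B(0,2ρ)` and every
`x` with `‖x‖ ≥ 4ρ`,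
`|∫ (E(x−y) − E(x)) f(y) dy| ≤ C ‖x‖⁻² ∫ |f|`, where `E(z) = 1/(4π‖z‖)`. -/
theorem newtonian_potential_difference_estimate
    (ρ : ℝ) (hρ : 0 < ρ) :
    ∃ C > 0, ∀ f : EuclideanSpace ℝ (Fin 3) → ℝ,
      Integrable f →
      Function.support f ⊆ Metric.closedBall 0 (2 * ρ) →
      ∀ x : EuclideanSpace ℝ (Fin 3), 4 * ρ ≤ ‖x‖ →
        |∫ y, ((4 * Real.pi * ‖x - y‖)⁻¹ - (4 * Real.pi * ‖x‖)⁻¹) * f y|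
          ≤ C * (‖x‖ ^ 2)⁻¹ * ∫ y, |f y| := by
  refine ⟨ρ / Real.pi, div_pos hρ Real.pi_pos, fun f hf hsupp x hx => ?_⟩
  have hx0 : 0 < ‖x‖ := by linarith
  rw [← integral_const_mul, ← Real.norm_eq_abs]
  refine norm_integral_le_of_norm_le (hf.abs.const_mul _) (.of_forall fun y => ?_)
  by_cases hfy : f y = 0
  · simp [hfy]
  have hy : ‖y‖ ≤ 2 * ρ := mem_closedBall_zero_iff.mp (hsupp hfy)
  rw [norm_mul, Real.norm_eq_abs, Real.norm_eq_abs]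
  gcongr
  rw [mul_inv, mul_inv _ ‖x‖, ← mul_sub, abs_mul,
    abs_of_pos (inv_pos.mpr (by positivity : 0 < 4 * Real.pi))]
  calc (4 * Real.pi)⁻¹ * |‖x - y‖⁻¹ - ‖x‖⁻¹|
      ≤ (4 * Real.pi)⁻¹ * (2 * ‖y‖ * (‖x‖ ^ 2)⁻¹) := by
        gcongr
        exact abs_inv_norm_sub_sub_inv_norm_le hx0 (by linarith)
    _ ≤ (4 * Real.pi)⁻¹ * (2 * (2 * ρ) * (‖x‖ ^ 2)⁻¹) := by gcongr
    _ = ρ / Real.pi * (‖x‖ ^ 2)⁻¹ := by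
        field_simp
        ring
end

section
/- Define f : (1,∞) → ℝ by f(A) := 16π ( A + (A²/2)·log((A−1)/(A+1)) + 4A/(3(A²−1)) ). Then f is strictly decreasing on (1,∞). -/
theorem log_sub_one_div_add_one_le {A : ℝ} (hA : 1 < A) :
    Real.log ((A - 1) / (A + 1)) ≤ -(2 / A) := by
  have h0 : 0 < A - 1 := sub_pos.2 hA
  have h1 : 0 < A + 1 := by linarith
  have h2 : 0 < A := by linarith
  have h := Real.le_log_one_add_of_nonneg (x := 2 / (A - 1)) (by positivity)
  have e1 : 2 * (2 / (A - 1)) / (2 / (A - 1) + 2) = 2 / A := by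
    have e : 2 / (A - 1) + 2 = 2 * A / (A - 1) := by field_simp; ring
    rw [e]
    field_simp
  have e2 : 1 + 2 / (A - 1) = ((A - 1) / (A + 1))⁻¹ := by
    rw [inv_div]
    field_simp
    ring
  rw [e1, e2, Real.log_inv] at h
  linarith

theorem hasDerivAt_landau_parameter_function {A : ℝ} (hA : 1 < A) :
    HasDerivAt
      (fun A : ℝ =>
        16 * Real.pi * (A + (A ^ 2 / 2) * Real.log ((A - 1) / (A + 1)) + 4 * A / (3 * (A ^ 2 - 1))))
      (16 * Real.pi * (1 + A * Real.log ((A - 1) / (A + 1)) + A ^ 2 / (A ^ 2 - 1)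
        - 4 * (A ^ 2 + 1) / (3 * (A ^ 2 - 1) ^ 2))) A := by
  have h0 : A - 1 ≠ 0 := by linarith
  have h1 : A + 1 ≠ 0 := by linarith
  have h2 : A ^ 2 - 1 ≠ 0 := by nlinarith
  have hid := hasDerivAt_id' A
  have hlog := ((hid.sub_const 1).fun_div (hid.add_const 1) h1).log (div_ne_zero h0 h1)
  have hsq := hid.fun_pow 2
  have hfrac := (hid.const_mul 4).fun_div ((hsq.sub_const 1).const_mul 3)
    (mul_ne_zero three_ne_zero h2)
  refine (((hid.fun_add ((hsq.div_const 2).fun_mul hlog)).fun_add hfrac).const_mul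
    (16 * Real.pi)).congr_deriv ?_
  have e : A ^ 2 - 1 = (A - 1) * (A + 1) := by ring
  rw [e]
  field_simp
  ring

/-- The function `f(A) = 16π(A + (A²/2)·log((A−1)/(A+1)) + 4A/(3(A²−1)))` of equation (4.16),
relating the Landau-solution parameter `A` to the force magnitude `β`, is strictly
decreasing on `(1,∞)`. -/
theorem landau_parameter_function_strictAnti :
    StrictAntiOn
      (fun A : ℝ =>
        16 * Real.pi * (A + (A ^ 2 / 2) * Real.log ((A - 1) / (A + 1)) + 4 * A / (3 * (A ^ 2 - 1))))
      (Set.Ioi 1) := by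
  refine strictAntiOn_of_deriv_neg (convex_Ioi 1)
    (fun A hA => (hasDerivAt_landau_parameter_function hA).continuousAt.continuousWithinAt) ?_
  intro A hA
  rw [interior_Ioi] at hA
  have hA : 1 < A := hA
  rw [(hasDerivAt_landau_parameter_function hA).deriv]
  refine mul_neg_of_pos_of_neg (by positivity) ?_
  have hpos : 0 < A ^ 2 - 1 := by nlinarith
  have hlog : A * Real.log ((A - 1) / (A + 1)) ≤ -2 := by
    have h := mul_le_mul_of_nonneg_left (log_sub_one_div_add_one_le hA) (by linarith : 0 ≤ A)
    rwa [mul_neg, mul_div_cancel₀ _ (by linarith : A ≠ 0)] at h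
  have hrat : -1 + A ^ 2 / (A ^ 2 - 1) - 4 * (A ^ 2 + 1) / (3 * (A ^ 2 - 1) ^ 2)
      = -((A ^ 2 + 7) / (3 * (A ^ 2 - 1) ^ 2)) := by
    field_simp
    ring
  have hneg : 0 < (A ^ 2 + 7) / (3 * (A ^ 2 - 1) ^ 2) := by positivity
  linarith
end

section
/- Define f : (1,∞) → ℝ by f(A) := 16π ( A + (A²/2)·log((A−1)/(A+1)) + 4A/(3(A²−1)) ). Then for every β > 0 there exists exactly one A ∈ (1,∞) such that f(A) = β. -/
open Real in
lemma log_sub_div_add_le {A : ℝ} (hA : 1 < A) : log ((A - 1) / (A + 1)) ≤ -2 / A := by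
  have h0 : 0 < A := by linarith
  have h := sum_range_le_log_div (x := A⁻¹) (by positivity) (inv_lt_one_of_one_lt₀ hA) 1
  have e : (1 + A⁻¹) / (1 - A⁻¹) = ((A - 1) / (A + 1))⁻¹ := by
    have : A - 1 ≠ 0 := by linarith
    field_simp
  rw [e, log_inv] at h
  norm_num at h
  have : -2 / A = -2 * A⁻¹ := div_eq_mul_inv _ _
  linarith

open Real in
lemma le_log_sub_div_add {A : ℝ} (hA : 1 < A) :
    -2 / A - 2 / (A * (A ^ 2 - 1)) ≤ log ((A - 1) / (A + 1)) := by
  have h0 : 0 < A := by linarith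
  have h1 : A - 1 ≠ 0 := by linarith
  have h2 : A ^ 2 - 1 ≠ 0 := by nlinarith
  have h := log_div_le_sum_range_add (x := A⁻¹) (by positivity) (inv_lt_one_of_one_lt₀ hA) 1
  have e : (1 + A⁻¹) / (1 - A⁻¹) = ((A - 1) / (A + 1))⁻¹ := by
    field_simp
  have e' : (A⁻¹) ^ 3 / (1 - A⁻¹ ^ 2) = 1 / (A * (A ^ 2 - 1)) := by
    field_simp
  rw [e, log_inv] at h
  norm_num only [Finset.sum_range_one] at h
  rw [e'] at h
  have h3 : -2 / A = -2 * A⁻¹ := div_eq_mul_inv _ _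
  have h4 : 2 / (A * (A ^ 2 - 1)) = 2 * (1 / (A * (A ^ 2 - 1))) := by ring
  rw [h3, h4]
  norm_num at h ⊢
  linarith

/-- The magnitude of the force of the Landau solution with parameter `A`, divided by `16π`. -/
noncomputable def landauForce (A : ℝ) : ℝ :=
  A + (A ^ 2 / 2) * Real.log ((A - 1) / (A + 1)) + 4 * A / (3 * (A ^ 2 - 1))

lemma hasDerivAt_landauForce {A : ℝ} (hA : 1 < A) :
    HasDerivAt landauForce (1 + A * Real.log ((A - 1) / (A + 1)) + A ^ 2 / (A ^ 2 - 1)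
      - 4 / 3 * (A ^ 2 + 1) / (A ^ 2 - 1) ^ 2) A := by
  have h1 : A - 1 ≠ 0 := by linarith
  have h2 : A + 1 ≠ 0 := by linarith
  have h3 : A ^ 2 - 1 ≠ 0 := by nlinarith
  have hid := hasDerivAt_id' A
  have hlog := ((hid.sub_const 1).div (hid.add_const 1) h2).log (div_ne_zero h1 h2)
  have hrat := (hid.const_mul 4).div (((hid.pow 2).sub_const 1).const_mul 3)
    (mul_ne_zero three_ne_zero h3)
  refine ((hid.add (((hid.pow 2).div_const 2).mul hlog)).add hrat).congr_deriv ?_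
  simp only [Pi.div_apply, Pi.pow_apply]
  have h4 : A ^ 2 - 1 = (A - 1) * (A + 1) := by ring
  rw [h4]
  field_simp
  ring

lemma strictAntiOn_landauForce : StrictAntiOn landauForce (Set.Ioi 1) := by
  refine strictAntiOn_of_deriv_neg (convex_Ioi 1)
    (fun A hA => (hasDerivAt_landauForce hA).continuousAt.continuousWithinAt) fun A hA => ?_
  rw [interior_Ioi] at hA
  have hA' : 1 < A := hA
  rw [(hasDerivAt_landauForce hA').deriv]
  have h0 : 0 < A := by linarith
  have hu : 0 < A ^ 2 - 1 := by nlinarith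
  have hlog : A * Real.log ((A - 1) / (A + 1)) ≤ -2 := by
    have h := mul_le_mul_of_nonneg_left (log_sub_div_add_le hA') h0.le
    rwa [mul_div_cancel₀ _ h0.ne'] at h
  have e : 1 + -2 + A ^ 2 / (A ^ 2 - 1) - 4 / 3 * (A ^ 2 + 1) / (A ^ 2 - 1) ^ 2
      = -((A ^ 2 + 7) / (3 * (A ^ 2 - 1) ^ 2)) := by
    field_simp
    ring
  have : 0 < (A ^ 2 + 7) / (3 * (A ^ 2 - 1) ^ 2) := by positivity
  linarith

lemma landauForce_le {A : ℝ} (hA : 1 < A) : landauForce A ≤ 4 * A / (3 * (A ^ 2 - 1)) := by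
  have h := mul_le_mul_of_nonneg_left (log_sub_div_add_le hA) (by positivity : 0 ≤ A ^ 2 / 2)
  have e : A ^ 2 / 2 * (-2 / A) = -A := by field_simp
  unfold landauForce
  linarith

lemma le_landauForce {A : ℝ} (hA : 1 < A) : A / (3 * (A ^ 2 - 1)) ≤ landauForce A := by
  have h := mul_le_mul_of_nonneg_left (le_log_sub_div_add hA) (by positivity : 0 ≤ A ^ 2 / 2)
  have hu : A ^ 2 - 1 ≠ 0 := by nlinarith
  have e : A / (3 * (A ^ 2 - 1)) = A + A ^ 2 / 2 * (-2 / A - 2 / (A * (A ^ 2 - 1)))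
      + 4 * A / (3 * (A ^ 2 - 1)) := by
    field_simp
    ring
  unfold landauForce
  linarith

lemma exists_landauForce_eq {c : ℝ} (hc : 0 < c) : ∃ A, 1 < A ∧ landauForce A = c := by
  have ha : 1 < 1 + 1 / (6 * c) := by simp [hc]
  have hb : 1 < 1 + 2 / c := by simp [hc]
  have hab : 1 + 1 / (6 * c) ≤ 1 + 2 / c := by
    gcongr
    · norm_num
    · linarith
  have hca : c ≤ landauForce (1 + 1 / (6 * c)) := by
    refine le_trans ?_ (le_landauForce ha)
    rw [le_div_iff₀ (by nlinarith)]
    have : c * (1 / (6 * c)) = 1 / 6 := by field_simp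
    nlinarith
  have hcb : landauForce (1 + 2 / c) ≤ c := by
    refine (landauForce_le hb).trans ?_
    rw [div_le_iff₀ (by nlinarith)]
    have : c * (2 / c) = 2 := by field_simp
    nlinarith
  obtain ⟨A, hA, hAc⟩ := intermediate_value_Icc' hab
    (fun x hx => (hasDerivAt_landauForce (ha.trans_le hx.1)).continuousAt.continuousWithinAt)
    ⟨hcb, hca⟩
  exact ⟨A, ha.trans_le hA.1, hAc⟩

/-- For every `β > 0` there is exactly one `A ∈ (1,∞)` with
`16π(A + (A²/2)·log((A−1)/(A+1)) + 4A/(3(A²−1))) = β`: uniqueness of the Landau solution. -/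
theorem landau_parameter_exists_unique (β : ℝ) (hβ : 0 < β) :
    ∃! A : ℝ, A ∈ Set.Ioi (1:ℝ) ∧
      16 * Real.pi * (A + (A ^ 2 / 2) * Real.log ((A - 1) / (A + 1)) + 4 * A / (3 * (A ^ 2 - 1)))
        = β := by
  have hpi : 0 < 16 * Real.pi := by positivity
  obtain ⟨A, hA, hAβ⟩ := exists_landauForce_eq (div_pos hβ hpi)
  refine ⟨A, ⟨hA, ?_⟩, fun B hB => strictAntiOn_landauForce.injOn hB.1 hA ?_⟩
  · exact (congrArg (16 * Real.pi * ·) hAβ).trans (mul_div_cancel₀ β hpi.ne')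
  · rw [hAβ, eq_div_iff hpi.ne', mul_comm]
    exact hB.2
end

section
/- Let A > 1. Then for every s ∈ [−1,1]: (i) |(A²−1)/(A−s)² − 1| ≤ 2/(A−1), and (ii) √(1−s²)/(A−s) ≤ 1/√(A²−1). Consequently, for every r > 0 and θ ∈ [0,π], the Landau velocity components U_r = (2/r)((A²−1)/(A−cos θ)² − 1) and U_θ = −2 sin θ/(r(A−cos θ)) satisfy r·(|U_r| + |U_θ|) ≤ 6/(A−1). -/
theorem abs_landau_radial_le {A s : ℝ} (hA : 1 < A) (hs : s ∈ Set.Icc (-1 : ℝ) 1) :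
    |(A ^ 2 - 1) / (A - s) ^ 2 - 1| ≤ 2 / (A - 1) := by
  obtain ⟨h₁, h₂⟩ := hs
  have hAs : 0 < A - s := by linarith
  have hA₁ : 0 < A - 1 := by linarith
  have hlow : (A - 1) ^ 2 ≤ (A - s) ^ 2 := by gcongr
  have hupp : (A - s) ^ 2 ≤ (A + 1) ^ 2 := by gcongr; linarith
  have hX : (A ^ 2 - 1) / (A - s) ^ 2 ≤ (A + 1) / (A - 1) := by
    rw [div_le_div_iff₀ (by positivity) hA₁]
    nlinarith
  have hY : (A - 1) / (A + 1) ≤ (A ^ 2 - 1) / (A - s) ^ 2 := by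
    rw [div_le_div_iff₀ (by linarith) (by positivity)]
    nlinarith
  have hX' : (A + 1) / (A - 1) = 1 + 2 / (A - 1) := by field_simp; ring
  have hY' : (A - 1) / (A + 1) = 1 - 2 / (A + 1) := by field_simp; ring
  have hle : 2 / (A + 1) ≤ 2 / (A - 1) := by gcongr; linarith
  rw [abs_le]
  constructor <;> linarith

theorem landau_angular_le {A s : ℝ} (hA : 1 < A) (hs : s ∈ Set.Icc (-1 : ℝ) 1) :
    Real.sqrt (1 - s ^ 2) / (A - s) ≤ 1 / Real.sqrt (A ^ 2 - 1) := by
  obtain ⟨h₁, h₂⟩ := hs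
  have hAs : 0 < A - s := by linarith
  have hA₂ : 0 < A ^ 2 - 1 := by nlinarith
  rw [div_le_div_iff₀ hAs (Real.sqrt_pos.2 hA₂), one_mul, ← Real.sqrt_mul (by nlinarith)]
  exact Real.sqrt_le_iff.2 ⟨hAs.le, by nlinarith [sq_nonneg (1 - A * s)]⟩

/-- Elementary bounds on the Landau velocity components (4.15): for `A > 1`,
(i) `|(A²−1)/(A−s)² − 1| ≤ 2/(A−1)` and (ii) `√(1−s²)/(A−s) ≤ 1/√(A²−1)` for `s ∈ [−1,1]`;
consequently `r·(|U_r| + |U_θ|) ≤ 6/(A−1)` for all `r > 0`, `θ ∈ [0,π]`. -/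
theorem landau_velocity_bounds (A : ℝ) (hA : 1 < A) :
    (∀ s ∈ Set.Icc (-1 : ℝ) 1, |(A ^ 2 - 1) / (A - s) ^ 2 - 1| ≤ 2 / (A - 1)) ∧
    (∀ s ∈ Set.Icc (-1 : ℝ) 1,
      Real.sqrt (1 - s ^ 2) / (A - s) ≤ 1 / Real.sqrt (A ^ 2 - 1)) ∧
    (∀ r : ℝ, 0 < r → ∀ θ ∈ Set.Icc (0 : ℝ) Real.pi,
      r * (|(2 / r) * ((A ^ 2 - 1) / (A - Real.cos θ) ^ 2 - 1)|
            + |(-(2 * Real.sin θ)) / (r * (A - Real.cos θ))|)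
        ≤ 6 / (A - 1)) := by
  refine ⟨fun s hs => abs_landau_radial_le hA hs, fun s hs => landau_angular_le hA hs, ?_⟩
  intro r hr θ hθ
  have hcos : Real.cos θ ∈ Set.Icc (-1 : ℝ) 1 := ⟨Real.neg_one_le_cos θ, Real.cos_le_one θ⟩
  have hAc : 0 < A - Real.cos θ := by linarith [hcos.2]
  have hA₁ : 0 < A - 1 := by linarith
  have hsin : 0 ≤ Real.sin θ := Real.sin_nonneg_of_mem_Icc hθ
  have hrad := abs_landau_radial_le hA hcos
  have hang : Real.sin θ / (A - Real.cos θ) ≤ 1 / (A - 1) := by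
    rw [Real.sin_eq_sqrt_one_sub_cos_sq hθ.1 hθ.2]
    refine (landau_angular_le hA hcos).trans ?_
    gcongr
    exact Real.le_sqrt_of_sq_le (by nlinarith)
  have hU : r * |(2 / r) * ((A ^ 2 - 1) / (A - Real.cos θ) ^ 2 - 1)|
      = 2 * |(A ^ 2 - 1) / (A - Real.cos θ) ^ 2 - 1| := by
    rw [abs_mul, abs_of_pos (by positivity : 0 < 2 / r), ← mul_assoc, mul_div_cancel₀ _ hr.ne']
  have hV : r * |(-(2 * Real.sin θ)) / (r * (A - Real.cos θ))|
      = 2 * (Real.sin θ / (A - Real.cos θ)) := by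
    rw [neg_div, abs_neg, abs_of_nonneg (by positivity)]
    field_simp
  have hsum : 6 / (A - 1) = 2 * (2 / (A - 1)) + 2 * (1 / (A - 1)) := by ring
  rw [mul_add, hU, hV, hsum]
  gcongr
end

section
/- Let α ∈ (0,1) and K₀ > 0. There exists ε > 0, depending only on α and K₀, with the following property. Let k : ℝ³ × ℝ³ → ℝ be measurable with |k(x,y)| ≤ K₀ ‖x−y‖⁻² for all x ≠ y; let a : ℝ³ → ℝ be measurable with sup_{x} (1+‖x‖)² |a(x)| < ∞; and let b : ℝ³ → ℝ be measurable with sup_{x} (1+‖x‖) |b(x)| ≤ ε. Then there exists exactly one measurable function ζ : ℝ³ → ℝ with sup_{x} (1+‖x‖) |ζ(x)| < ∞ satisfying ζ(x) = a(x) + ∫_{ℝ³} k(x,y) b(y) ζ(y) dy for every x ∈ ℝ³, and this ζ moreover satisfies sup_{x} (1+‖x‖)^{1+α} |ζ(x)| < ∞. -/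
open MeasureTheory

/-- The power `r ^ (-p)` truncated to `r ≤ R` has the expected integral over `ℝ³`. -/
lemma radial_rpow_inner {p R : ℝ} (hp : p < 3) (hR : 0 < R) :
    Integrable (fun z : EuclideanSpace ℝ (Fin 3) =>
      (Set.Iic R).indicator (fun r : ℝ => r ^ (-p)) ‖z‖) ∧
    ∫ z : EuclideanSpace ℝ (Fin 3), (Set.Iic R).indicator (fun r : ℝ => r ^ (-p)) ‖z‖ =
      3 * volume.real (Metric.ball (0 : EuclideanSpace ℝ (Fin 3)) 1) *
        (R ^ (3 - p) / (3 - p)) := by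
  have hset : Set.Ioi (0 : ℝ) ∩ Set.Iic R = Set.Ioc 0 R := Set.Ioi_inter_Iic
  have key : Set.EqOn (fun y : ℝ => y ^ 2 • (Set.Iic R).indicator (fun r : ℝ => r ^ (-p)) y)
      ((Set.Iic R).indicator fun r : ℝ => r ^ (2 - p)) (Set.Ioi 0) := by
    intro y hy
    have hy : 0 < y := hy
    by_cases h : y ∈ Set.Iic R
    · simp only [Set.indicator_of_mem h, smul_eq_mul]
      rw [← Real.rpow_natCast, ← Real.rpow_add hy]
      norm_num [sub_eq_add_neg]
    · simp [Set.indicator_of_notMem h]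
  constructor
  · rw [integrable_fun_norm_addHaar, finrank_euclideanSpace_fin,
      integrableOn_congr_fun key measurableSet_Ioi, IntegrableOn,
      integrable_indicator_iff measurableSet_Iic, IntegrableOn,
      Measure.restrict_restrict measurableSet_Iic, Set.inter_comm, hset, ← IntegrableOn,
      ← intervalIntegrable_iff_integrableOn_Ioc_of_le hR.le]
    exact intervalIntegral.intervalIntegrable_rpow' (by linarith)
  · rw [integral_fun_norm_addHaar, finrank_euclideanSpace_fin,
      setIntegral_congr_fun measurableSet_Ioi key, setIntegral_indicator measurableSet_Iic, hset,
      ← intervalIntegral.integral_of_le hR.le, integral_rpow (Or.inl (by linarith)),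
      Real.zero_rpow (by linarith)]
    simp only [nsmul_eq_mul, smul_eq_mul]
    ring_nf

/-- The power `r ^ (-p)` truncated to `r > R` has the expected integral over `ℝ³`. -/
lemma radial_rpow_outer {p R : ℝ} (hp : 3 < p) (hR : 0 < R) :
    Integrable (fun z : EuclideanSpace ℝ (Fin 3) =>
      (Set.Ioi R).indicator (fun r : ℝ => r ^ (-p)) ‖z‖) ∧
    ∫ z : EuclideanSpace ℝ (Fin 3), (Set.Ioi R).indicator (fun r : ℝ => r ^ (-p)) ‖z‖ =
      3 * volume.real (Metric.ball (0 : EuclideanSpace ℝ (Fin 3)) 1) *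
        (R ^ (3 - p) / (p - 3)) := by
  have hset : Set.Ioi (0 : ℝ) ∩ Set.Ioi R = Set.Ioi R :=
    Set.inter_eq_right.2 (Set.Ioi_subset_Ioi hR.le)
  have key : Set.EqOn (fun y : ℝ => y ^ 2 • (Set.Ioi R).indicator (fun r : ℝ => r ^ (-p)) y)
      ((Set.Ioi R).indicator fun r : ℝ => r ^ (2 - p)) (Set.Ioi 0) := by
    intro y hy
    have hy : 0 < y := hy
    by_cases h : y ∈ Set.Ioi R
    · simp only [Set.indicator_of_mem h, smul_eq_mul]
      rw [← Real.rpow_natCast, ← Real.rpow_add hy]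
      norm_num [sub_eq_add_neg]
    · simp [Set.indicator_of_notMem h]
  constructor
  · rw [integrable_fun_norm_addHaar, finrank_euclideanSpace_fin,
      integrableOn_congr_fun key measurableSet_Ioi, IntegrableOn,
      integrable_indicator_iff measurableSet_Ioi, IntegrableOn,
      Measure.restrict_restrict measurableSet_Ioi, Set.inter_comm, hset, ← IntegrableOn]
    exact integrableOn_Ioi_rpow_of_lt (by linarith) hR
  · rw [integral_fun_norm_addHaar, finrank_euclideanSpace_fin,
      setIntegral_congr_fun measurableSet_Ioi key, setIntegral_indicator measurableSet_Ioi, hset,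
      integral_Ioi_rpow_of_lt (by linarith) hR, show 2 - p + 1 = -(p - 3) by ring, neg_div_neg_eq]
    simp only [nsmul_eq_mul, smul_eq_mul]
    ring_nf

lemma riesz_weight_pointwise {β R d r s : ℝ} (hβ : β ∈ Set.Ioo (0 : ℝ) 2) (hd : 0 ≤ d)
    (hR : R = 1 + d) (hr : 0 < r) (hs : 0 < s) (h₁ : d ≤ r + s) (h₂ : s ≤ d + r) :
    (r ^ 2)⁻¹ * (1 + s) ^ (-(1 + β)) ≤
      8 * R ^ (-(1 + β)) * (Set.Iic R).indicator (fun r : ℝ => r ^ (-2 : ℝ)) r +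
      4 * R ^ (-2 : ℝ) * (Set.Iic R).indicator (fun r : ℝ => r ^ (-(1 + β))) s +
      9 * (Set.Ioi R).indicator (fun r : ℝ => r ^ (-(3 + β))) s := by
  obtain ⟨hβ0, hβ2⟩ := hβ
  have hR0 : 0 < R := by linarith
  have two (t : ℝ) (ht : 0 < t) : t ^ (-2 : ℝ) = (t ^ 2)⁻¹ := by
    rw [Real.rpow_neg ht.le]; norm_num
  have n₁ : 0 ≤ 8 * R ^ (-(1 + β)) * (Set.Iic R).indicator (fun r : ℝ => r ^ (-2 : ℝ)) r :=
    mul_nonneg (by positivity) (Set.indicator_apply_nonneg fun _ => by positivity)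
  have n₂ : 0 ≤ 4 * R ^ (-2 : ℝ) * (Set.Iic R).indicator (fun r : ℝ => r ^ (-(1 + β))) s :=
    mul_nonneg (by positivity) (Set.indicator_apply_nonneg fun _ => by positivity)
  have n₃ : 0 ≤ 9 * (Set.Ioi R).indicator (fun r : ℝ => r ^ (-(3 + β))) s :=
    mul_nonneg (by positivity) (Set.indicator_apply_nonneg fun _ => by positivity)
  by_cases hrR : r ≤ R / 2
  · have e : (1 + s) ^ (-(1 + β)) ≤ 8 * R ^ (-(1 + β)) := by
      calc (1 + s) ^ (-(1 + β)) ≤ (R / 2) ^ (-(1 + β)) :=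
            Real.rpow_le_rpow_of_nonpos (by linarith) (by linarith) (by linarith)
        _ = 2 ^ (1 + β) * R ^ (-(1 + β)) := by
            rw [Real.div_rpow hR0.le (by norm_num), Real.rpow_neg (by norm_num : (0 : ℝ) ≤ 2)]
            field_simp
        _ ≤ 2 ^ (3 : ℝ) * R ^ (-(1 + β)) := by
            gcongr <;> linarith
        _ = 8 * R ^ (-(1 + β)) := by norm_num
    rw [Set.indicator_of_mem (show r ∈ Set.Iic R by simp only [Set.mem_Iic]; linarith), two r hr]
      at *
    have := mul_le_mul_of_nonneg_left e (by positivity : 0 ≤ (r ^ 2)⁻¹)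
    linarith
  · push Not at hrR
    have es : (1 + s) ^ (-(1 + β)) ≤ s ^ (-(1 + β)) :=
      Real.rpow_le_rpow_of_nonpos hs (by linarith) (by linarith)
    by_cases hsR : s ≤ R
    · have e : (r ^ 2)⁻¹ ≤ 4 * R ^ (-2 : ℝ) := by
        rw [two R hR0, show 4 * (R ^ 2)⁻¹ = ((R / 2) ^ 2)⁻¹ by field_simp; norm_num]
        gcongr
      rw [Set.indicator_of_mem (show s ∈ Set.Iic R from hsR)] at *
      have := mul_le_mul e es (by positivity) (by positivity)
      linarith
    · push Not at hsR
      have e : (r ^ 2)⁻¹ ≤ 9 * s ^ (-2 : ℝ) := by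
        rw [two s hs, show 9 * (s ^ 2)⁻¹ = ((s / 3) ^ 2)⁻¹ by field_simp; norm_num]
        gcongr
        linarith
      have e₃ : s ^ (-(3 + β)) = s ^ (-2 : ℝ) * s ^ (-(1 + β)) := by
        rw [← Real.rpow_add hs]; ring_nf
      rw [Set.indicator_of_mem (show s ∈ Set.Ioi R from hsR), e₃] at *
      have := mul_le_mul e es (by positivity) (by positivity)
      linarith

/-- Convolution with `‖·‖⁻²` on `ℝ³` maps the decay rate `1 + β` to the decay rate `β`. -/
lemma riesz_weight_bound {β : ℝ} (hβ : β ∈ Set.Ioo (0 : ℝ) 2) :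
    ∃ C > 0, ∀ x : EuclideanSpace ℝ (Fin 3),
      Integrable (fun y => (‖x - y‖ ^ 2)⁻¹ * (1 + ‖y‖) ^ (-(1 + β))) ∧
      ∫ y, (‖x - y‖ ^ 2)⁻¹ * (1 + ‖y‖) ^ (-(1 + β)) ≤ C * (1 + ‖x‖) ^ (-β) := by
  set c := 3 * volume.real (Metric.ball (0 : EuclideanSpace ℝ (Fin 3)) 1) with hc
  have hc0 : 0 ≤ c := by positivity
  have hβ0 := hβ.1
  have hβ2 : 0 < 2 - β := by linarith [hβ.2]
  refine ⟨8 * c + 4 * c / (2 - β) + 9 * c / β + 1, by positivity, fun x => ?_⟩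
  set R := 1 + ‖x‖ with hR
  have hR0 : 0 < R := by positivity
  obtain ⟨i₁, v₁⟩ := radial_rpow_inner (p := 2) (by norm_num) hR0
  obtain ⟨i₂, v₂⟩ := radial_rpow_inner (p := 1 + β) (by linarith) hR0
  obtain ⟨i₃, v₃⟩ := radial_rpow_outer (p := 3 + β) (by linarith) hR0
  rw [← integral_sub_left_eq_self _ volume x] at v₁
  replace i₁ := (i₁.comp_sub_left x).const_mul (8 * R ^ (-(1 + β)))
  replace i₂ := i₂.const_mul (4 * R ^ (-2 : ℝ))
  replace i₃ := i₃.const_mul 9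
  have hle : ∀ᵐ y : EuclideanSpace ℝ (Fin 3),
      (‖x - y‖ ^ 2)⁻¹ * (1 + ‖y‖) ^ (-(1 + β)) ≤
      8 * R ^ (-(1 + β)) * (Set.Iic R).indicator (fun r : ℝ => r ^ (-2 : ℝ)) ‖x - y‖ +
      4 * R ^ (-2 : ℝ) * (Set.Iic R).indicator (fun r : ℝ => r ^ (-(1 + β))) ‖y‖ +
      9 * (Set.Ioi R).indicator (fun r : ℝ => r ^ (-(3 + β))) ‖y‖ := by
    filter_upwards [Measure.ae_ne volume x, Measure.ae_ne volume 0] with y hyx hy0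
    refine riesz_weight_pointwise hβ (norm_nonneg x) hR (norm_pos_iff.2 (sub_ne_zero.2 hyx.symm))
      (norm_pos_iff.2 hy0) ?_ ?_
    · simpa using norm_add_le (x - y) y
    · simpa using norm_sub_le x (x - y)
  have hint : Integrable fun y : EuclideanSpace ℝ (Fin 3) =>
      (‖x - y‖ ^ 2)⁻¹ * (1 + ‖y‖) ^ (-(1 + β)) := by
    refine ((i₁.add i₂).add i₃).mono' (by fun_prop) ?_
    filter_upwards [hle] with y hy
    rwa [Real.norm_of_nonneg (by positivity)]
  refine ⟨hint, (integral_mono_ae hint ((i₁.add i₂).add i₃) hle).trans ?_⟩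
  rw [integral_add' (i₁.add i₂) i₃, integral_add' i₁ i₂]
  simp only [integral_const_mul]
  rw [v₁, v₂, v₃, ← hc]
  have e₁ : R ^ (-(1 + β)) * R ^ ((3 : ℝ) - 2) = R ^ (-β) := by
    rw [← Real.rpow_add hR0]; ring_nf
  have e₂ : R ^ (-2 : ℝ) * R ^ (3 - (1 + β)) = R ^ (-β) := by
    rw [← Real.rpow_add hR0]; ring_nf
  have e₃ : R ^ (3 - (3 + β)) = R ^ (-β) := by ring_nf
  have hpos : 0 ≤ R ^ (-β) := by positivity
  calc _ = 8 * c * (R ^ (-(1 + β)) * R ^ ((3 : ℝ) - 2))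
        + 4 * c / (2 - β) * (R ^ (-2 : ℝ) * R ^ (3 - (1 + β)))
        + 9 * c / β * R ^ (3 - (3 + β)) := by
          rw [show 3 - (1 + β) = 2 - β by ring, show 3 + β - 3 = β by ring]
          field_simp
          norm_num
    _ = (8 * c + 4 * c / (2 - β) + 9 * c / β) * R ^ (-β) := by rw [e₁, e₂, e₃]; ring
    _ ≤ _ := mul_le_mul_of_nonneg_right (by linarith) hpos

/-- The integral operator with kernel `k x y * b y` preserves the decay rate `β`. -/
lemma kernel_operator_bound {β C K₀ ε M : ℝ}
    {k : EuclideanSpace ℝ (Fin 3) → EuclideanSpace ℝ (Fin 3) → ℝ}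
    {b f : EuclideanSpace ℝ (Fin 3) → ℝ} (hK₀ : 0 ≤ K₀) (hε : 0 ≤ ε)
    (hC : ∀ x : EuclideanSpace ℝ (Fin 3),
      Integrable (fun y => (‖x - y‖ ^ 2)⁻¹ * (1 + ‖y‖) ^ (-(1 + β))) ∧
      ∫ y, (‖x - y‖ ^ 2)⁻¹ * (1 + ‖y‖) ^ (-(1 + β)) ≤ C * (1 + ‖x‖) ^ (-β))
    (hkm : Measurable (Function.uncurry k))
    (hk : ∀ x y, x ≠ y → |k x y| ≤ K₀ * (‖x - y‖ ^ 2)⁻¹)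
    (hbm : Measurable b) (hb : ∀ x, (1 + ‖x‖) * |b x| ≤ ε)
    (hfm : Measurable f) (hf : ∀ x, |f x| ≤ M * (1 + ‖x‖) ^ (-β))
    (x : EuclideanSpace ℝ (Fin 3)) :
    Integrable (fun y => k x y * b y * f y) ∧
      ∫ y, ‖k x y * b y * f y‖ ≤ K₀ * ε * C * M * (1 + ‖x‖) ^ (-β) := by
  have hM : 0 ≤ M := by simpa using (abs_nonneg _).trans (hf 0)
  have hkx : Measurable (k x) := hkm.of_uncurry_left
  have hle : ∀ᵐ y, ‖k x y * b y * f y‖ ≤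
      K₀ * ε * M * ((‖x - y‖ ^ 2)⁻¹ * (1 + ‖y‖) ^ (-(1 + β))) := by
    filter_upwards [Measure.ae_ne volume x] with y hy
    have hpos : 0 < 1 + ‖y‖ := by positivity
    have hby : |b y| ≤ ε * (1 + ‖y‖) ^ (-1 : ℝ) := by
      rw [Real.rpow_neg_one, ← div_eq_mul_inv, le_div_iff₀' hpos]
      exact hb y
    have e : (1 + ‖y‖) ^ (-(1 + β)) = (1 + ‖y‖) ^ (-1 : ℝ) * (1 + ‖y‖) ^ (-β) := by
      rw [← Real.rpow_add hpos]; ring_nf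
    rw [norm_mul, norm_mul, Real.norm_eq_abs, Real.norm_eq_abs, Real.norm_eq_abs]
    calc |k x y| * |b y| * |f y| ≤ (K₀ * (‖x - y‖ ^ 2)⁻¹) * (ε * (1 + ‖y‖) ^ (-1 : ℝ)) *
          (M * (1 + ‖y‖) ^ (-β)) := by
          gcongr
          · exact hk x y hy.symm
          · exact hf y
      _ = _ := by rw [e]; ring
  have hmaj := (hC x).1.const_mul (K₀ * ε * M)
  have hint := hmaj.mono' ((hkx.mul hbm).mul hfm).aestronglyMeasurable hle
  refine ⟨hint, (integral_mono_ae hint.norm hmaj hle).trans ?_⟩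
  rw [integral_const_mul]
  have := mul_le_mul_of_nonneg_left (hC x).2 (by positivity : 0 ≤ K₀ * ε * M)
  linarith

lemma one_add_norm_rpow_mul_abs_le_iff {β M t : ℝ} (x : EuclideanSpace ℝ (Fin 3)) :
    (1 + ‖x‖) ^ β * |t| ≤ M ↔ |t| ≤ M * (1 + ‖x‖) ^ (-β) := by
  have hpos : 0 < 1 + ‖x‖ := by positivity
  rw [Real.rpow_neg hpos.le, ← div_eq_mul_inv, le_div_iff₀' (by positivity)]

/-- Abstract fixed-point statement behind the contraction argument (4.10)–(4.13) of
Lemma 4.2: for `α ∈ (0,1)` and `K₀ > 0` there is `ε > 0` such that for any kernel `k` with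
`|k(x,y)| ≤ K₀‖x−y‖⁻²`, any measurable `a` with `(1+‖x‖)²|a(x)|` bounded, and any measurable
`b` with `(1+‖x‖)|b(x)| ≤ ε`, the integral equation `ζ = a + ∫ k b ζ` has exactly one
measurable solution `ζ` with `(1+‖x‖)|ζ(x)|` bounded, and this solution moreover satisfies
`sup (1+‖x‖)^{1+α}|ζ(x)| < ∞`. -/
theorem contraction_integral_equation
    (α K₀ : ℝ) (hα : α ∈ Set.Ioo (0:ℝ) 1) (hK₀ : 0 < K₀) :
    ∃ ε > 0, ∀ (k : EuclideanSpace ℝ (Fin 3) → EuclideanSpace ℝ (Fin 3) → ℝ)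
      (a b : EuclideanSpace ℝ (Fin 3) → ℝ),
      Measurable (Function.uncurry k) →
      (∀ x y, x ≠ y → |k x y| ≤ K₀ * (‖x - y‖ ^ 2)⁻¹) →
      Measurable a → (∃ M : ℝ, ∀ x, (1 + ‖x‖) ^ 2 * |a x| ≤ M) →
      Measurable b → (∀ x, (1 + ‖x‖) * |b x| ≤ ε) →
      ∃ ζ : EuclideanSpace ℝ (Fin 3) → ℝ,
        (Measurable ζ ∧ (∃ M : ℝ, ∀ x, (1 + ‖x‖) * |ζ x| ≤ M) ∧
          (∀ x, ζ x = a x + ∫ y, k x y * b y * ζ y)) ∧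
        (∃ M : ℝ, ∀ x, (1 + ‖x‖) ^ (1 + α) * |ζ x| ≤ M) ∧
        (∀ ζ' : EuclideanSpace ℝ (Fin 3) → ℝ,
          (Measurable ζ' ∧ (∃ M : ℝ, ∀ x, (1 + ‖x‖) * |ζ' x| ≤ M) ∧
            (∀ x, ζ' x = a x + ∫ y, k x y * b y * ζ' y)) → ζ' = ζ) := by
  obtain ⟨hα0, hα1⟩ := hα
  obtain ⟨C₁, hC₁0, hC₁⟩ := riesz_weight_bound (β := 1) (by norm_num)
  obtain ⟨C₂, hC₂0, hC₂⟩ := riesz_weight_bound (β := 1 + α) ⟨by linarith, by linarith⟩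
  set ε := (2 * K₀ * (C₁ + C₂))⁻¹ with hεdef
  have hε : 0 < ε := by positivity
  have hθ : K₀ * ε * (C₁ + C₂) = 1 / 2 := by rw [hεdef]; field_simp
  have hθ₁ : K₀ * ε * C₁ ≤ 1 / 2 := by
    have : 0 < K₀ * ε * C₂ := by positivity
    linarith
  have hθ₂ : K₀ * ε * C₂ ≤ 1 / 2 := by
    have : 0 < K₀ * ε * C₁ := by positivity
    linarith
  refine ⟨ε, hε, fun k a b hkm hk ham ⟨A, hA⟩ hbm hb => ?_⟩
  have contract {β C : ℝ} (hθC : K₀ * ε * C ≤ 1 / 2)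
      (hC : ∀ x : EuclideanSpace ℝ (Fin 3),
        Integrable (fun y => (‖x - y‖ ^ 2)⁻¹ * (1 + ‖y‖) ^ (-(1 + β))) ∧
        ∫ y, (‖x - y‖ ^ 2)⁻¹ * (1 + ‖y‖) ^ (-(1 + β)) ≤ C * (1 + ‖x‖) ^ (-β))
      {f : EuclideanSpace ℝ (Fin 3) → ℝ} (hfm : Measurable f) {M : ℝ}
      (hf : ∀ x, |f x| ≤ M * (1 + ‖x‖) ^ (-β)) (x : EuclideanSpace ℝ (Fin 3)) :
      Integrable (fun y => k x y * b y * f y) ∧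
        ∫ y, ‖k x y * b y * f y‖ ≤ M / 2 * (1 + ‖x‖) ^ (-β) := by
    obtain ⟨hi, hn⟩ := kernel_operator_bound hK₀.le hε.le hC hkm hk hbm hb hfm hf x
    have hM : 0 ≤ M := by simpa using (abs_nonneg _).trans (hf 0)
    refine ⟨hi, hn.trans ?_⟩
    have := mul_le_mul_of_nonneg_right hθC hM
    gcongr
    linarith
  -- The Picard iterates, whose sum is the solution.
  let T : (EuclideanSpace ℝ (Fin 3) → ℝ) → EuclideanSpace ℝ (Fin 3) → ℝ :=
    fun f x => ∫ y, k x y * b y * f y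
  let u : ℕ → EuclideanSpace ℝ (Fin 3) → ℝ := fun n => T^[n] a
  have hu_succ (n : ℕ) (x : EuclideanSpace ℝ (Fin 3)) :
      u (n + 1) x = ∫ y, k x y * b y * u n y := by
    simp only [u, Function.iterate_succ_apply', T]
  have hum (n : ℕ) : Measurable (u n) := by
    induction n with
    | zero => exact ham
    | succ n ih =>
      have : u (n + 1) = fun x => ∫ y, k x y * b y * u n y := funext (hu_succ n)
      rw [this]
      refine (StronglyMeasurable.integral_prod_right ?_).measurable
      exact ((hkm.mul (hbm.comp measurable_snd)).mul (ih.comp measurable_snd)).stronglyMeasurable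
  have hA0 : 0 ≤ A := le_trans (by positivity) (hA 0)
  have hub (n : ℕ) : ∀ x, |u n x| ≤ A * (1 / 2) ^ n * (1 + ‖x‖) ^ (-(1 + α)) := by
    induction n with
    | zero =>
      intro x
      rw [pow_zero, mul_one, ← one_add_norm_rpow_mul_abs_le_iff]
      refine le_trans (mul_le_mul_of_nonneg_right ?_ (abs_nonneg _)) (hA x)
      rw [← Real.rpow_natCast (1 + ‖x‖) 2]
      refine Real.rpow_le_rpow_of_exponent_le (by linarith [norm_nonneg x]) ?_
      push_cast
      linarith
    | succ n ih =>
      intro x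
      rw [hu_succ]
      refine (norm_integral_le_integral_norm _).trans ((contract hθ₂ hC₂ (hum n) ih x).2.trans ?_)
      rw [pow_succ]
      exact le_of_eq (by ring)
  have hgeo (x : EuclideanSpace ℝ (Fin 3)) :
      HasSum (fun n : ℕ => A * (1 / 2) ^ n * (1 + ‖x‖) ^ (-(1 + α)))
        (A * 2 * (1 + ‖x‖) ^ (-(1 + α))) :=
    (hasSum_geometric_two.mul_left A).mul_right _
  have hus (x : EuclideanSpace ℝ (Fin 3)) : Summable fun n => u n x :=
    (hgeo x).summable.of_norm_bounded fun n => hub n x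
  let ζ : EuclideanSpace ℝ (Fin 3) → ℝ := fun x => ∑' n, u n x
  have hζm : Measurable ζ := by
    refine measurable_of_tendsto_metrizable
      (f := fun N x => ∑ n ∈ Finset.range N, u n x) (fun N => ?_) ?_
    · exact Finset.measurable_fun_sum _ fun n _ => hum n
    · exact tendsto_pi_nhds.2 fun x => (hus x).hasSum.tendsto_sum_nat
  have hζb (x : EuclideanSpace ℝ (Fin 3)) : |ζ x| ≤ A * 2 * (1 + ‖x‖) ^ (-(1 + α)) :=
    tsum_of_norm_bounded (f := fun n => u n x) (hgeo x) fun n => hub n x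
  have hζ₁ (x : EuclideanSpace ℝ (Fin 3)) : |ζ x| ≤ A * 2 * (1 + ‖x‖) ^ (-1 : ℝ) := by
    refine (hζb x).trans ?_
    gcongr
    · linarith [norm_nonneg x]
    · linarith
  have hζeq (x : EuclideanSpace ℝ (Fin 3)) : ζ x = a x + ∫ y, k x y * b y * ζ y := by
    have hsum := hasSum_integral_of_summable_integral_norm (μ := volume)
      (F := fun n y => k x y * b y * u n y)
      (fun n => (contract hθ₂ hC₂ (hum n) (hub n) x).1)
      (Summable.of_nonneg_of_le (fun n => integral_nonneg fun _ => norm_nonneg _)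
        (fun n => (contract hθ₂ hC₂ (hum n) (hub n) x).2)
        (((hgeo x).summable.div_const 2).congr fun n => by ring))
    simp only [tsum_mul_left] at hsum
    rw [show ζ x = u 0 x + ∑' n, u (n + 1) x from (hus x).tsum_eq_zero_add]
    simp only [hu_succ]
    rw [hsum.tsum_eq]
    rfl
  refine ⟨ζ, ⟨hζm, ⟨A * 2, fun x => ?_⟩, hζeq⟩, ⟨A * 2, fun x =>
    (one_add_norm_rpow_mul_abs_le_iff x).2 (hζb x)⟩, ?_⟩
  · simpa using (one_add_norm_rpow_mul_abs_le_iff x).2 (hζ₁ x)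
  rintro ζ' ⟨hζ'm, ⟨M, hM⟩, hζ'eq⟩
  have hζ'₁ (x : EuclideanSpace ℝ (Fin 3)) : |ζ' x| ≤ M * (1 + ‖x‖) ^ (-1 : ℝ) :=
    (one_add_norm_rpow_mul_abs_le_iff x).1 (by simpa using hM x)
  have hdeq (x : EuclideanSpace ℝ (Fin 3)) :
      ζ' x - ζ x = ∫ y, k x y * b y * (ζ' y - ζ y) := by
    rw [hζ'eq x, hζeq x, add_sub_add_left_eq_sub,
      ← integral_sub (contract hθ₁ hC₁ hζ'm hζ'₁ x).1 (contract hθ₁ hC₁ hζm hζ₁ x).1]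
    simp only [mul_sub]
  have hdb (n : ℕ) : ∀ x, |ζ' x - ζ x| ≤ (M + A * 2) * (1 / 2) ^ n * (1 + ‖x‖) ^ (-1 : ℝ) := by
    induction n with
    | zero =>
      intro x
      have := abs_sub (ζ' x) (ζ x)
      have h₁ := hζ'₁ x
      have h₂ := hζ₁ x
      rw [pow_zero, mul_one, add_mul]
      linarith
    | succ n ih =>
      intro x
      rw [hdeq]
      refine (norm_integral_le_integral_norm _).trans
        ((contract hθ₁ hC₁ (hζ'm.sub hζm) ih x).2.trans ?_)
      rw [pow_succ]
      exact le_of_eq (by ring)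
  funext x
  have hlim : Filter.Tendsto (fun n : ℕ => (M + A * 2) * (1 / 2) ^ n * (1 + ‖x‖) ^ (-1 : ℝ))
      Filter.atTop (nhds 0) := by
    simpa using ((tendsto_pow_atTop_nhds_zero_of_lt_one (r := (1 / 2 : ℝ)) (by norm_num)
      (by norm_num)).const_mul (M + A * 2)).mul_const ((1 + ‖x‖) ^ (-1 : ℝ))
  have h0 : |ζ' x - ζ x| ≤ 0 := ge_of_tendsto' hlim fun n => hdb n x
  exact sub_eq_zero.1 (abs_nonpos_iff.1 h0)
end
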